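/- Let r ≥ 1 be an integer and let t be a complex number with |t| < 1. Then the family (n₁,n₂,n₃) ↦ t^{(4r−4)(n₁−n₃)+|n₁|+|n₂|+|n₃|} indexed by triples of integers n₁ > n₂ > n₃ is absolutely summable and Σ_{n₁>n₂>n₃∈ℤ} t^{(4r−4)(n₁−n₃)+|n₁|+|n₂|+|n₃|} = 2t^{8r−5}/((1−t³)(1−t^{4r−3})(1−t^{4r−2})) + 2t^{12r−8}/((1−t^{4r−3})²(1−t^{4r−2})) + t^{8r−6}/(1−t^{4r−3})². -/

import Mathlib

section helpers
variable {K : Type*} [NormedField K] [CompleteSpace K]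

theorem mono_aux_norm (t : K) (ht : ‖t‖ < 1) (x : ℕ) (hx : x ≠ 0) : ‖t ^ x‖ < 1 := by
  rw [norm_pow]; exact pow_lt_one₀ (norm_nonneg _) ht hx

theorem mono_aux_two (u v : K) (hu : ‖u‖ < 1) (hv : ‖v‖ < 1) :
    HasSum (fun p : ℕ × ℕ => u ^ p.1 * v ^ p.2) ((1 - u)⁻¹ * (1 - v)⁻¹) ∧
    Summable (fun p : ℕ × ℕ => ‖u ^ p.1 * v ^ p.2‖) := by
  have su : Summable (fun n : ℕ => ‖u ^ n‖) := by
    simpa [norm_pow] using summable_geometric_of_lt_one (norm_nonneg u) hu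
  have sv : Summable (fun n : ℕ => ‖v ^ n‖) := by
    simpa [norm_pow] using summable_geometric_of_lt_one (norm_nonneg v) hv
  exact ⟨(hasSum_geometric_of_norm_lt_one hu).mul (hasSum_geometric_of_norm_lt_one hv)
    (summable_mul_of_summable_norm su sv), su.mul_norm sv⟩

theorem mono_aux_three (u v w : K) (hu : ‖u‖ < 1) (hv : ‖v‖ < 1) (hw : ‖w‖ < 1) :
    HasSum (fun p : ℕ × ℕ × ℕ => u ^ p.1 * (v ^ p.2.1 * w ^ p.2.2))
      ((1 - u)⁻¹ * ((1 - v)⁻¹ * (1 - w)⁻¹)) := by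
  have su : Summable (fun n : ℕ => ‖u ^ n‖) := by
    simpa [norm_pow] using summable_geometric_of_lt_one (norm_nonneg u) hu
  obtain ⟨h1, h2⟩ := mono_aux_two v w hv hw
  have h3 : Summable (fun p : ℕ × (ℕ × ℕ) =>
      (fun n : ℕ => u ^ n) p.1 * (fun q : ℕ × ℕ => v ^ q.1 * w ^ q.2) p.2) :=
    summable_mul_of_summable_norm (f := fun n : ℕ => u ^ n)
      (g := fun q : ℕ × ℕ => v ^ q.1 * w ^ q.2) su h2
  exact HasSum.mul (f := fun n : ℕ => u ^ n) (g := fun q : ℕ × ℕ => v ^ q.1 * w ^ q.2)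
    (hasSum_geometric_of_norm_lt_one hu) h1 h3

abbrev MonoIdx := {p : ℤ × ℤ × ℤ // p.2.1 < p.1 ∧ p.2.2 < p.2.1}

def monoMap : ((ℕ × ℕ × ℕ) ⊕ (ℕ × ℕ × ℕ)) ⊕ (((ℕ × ℕ × ℕ) ⊕ (ℕ × ℕ × ℕ)) ⊕ (ℕ × ℕ)) → MonoIdx
  | .inl (.inl (a, b, c)) => ⟨(c + 2 + a + b, c + 1 + b, c), by constructor <;> simp only <;> omega⟩
  | .inl (.inr (a, b, c)) =>
      ⟨(-c, -(c + 1 + b), -(c + 2 + a + b)), by constructor <;> simp only <;> omega⟩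
  | .inr (.inl (.inl (a, b, c))) =>
      ⟨(2 + a + b, 1 + b, -(1 + c)), by constructor <;> simp only <;> omega⟩
  | .inr (.inl (.inr (a, b, c))) =>
      ⟨(1 + c, -(1 + b), -(2 + a + b)), by constructor <;> simp only <;> omega⟩
  | .inr (.inr (a, c)) => ⟨(1 + a, 0, -(1 + c)), by constructor <;> simp only <;> omega⟩

theorem monoMap_bij : Function.Bijective monoMap := by
  constructor
  · rintro ((⟨a, b, c⟩ | ⟨a, b, c⟩) | ((⟨a, b, c⟩ | ⟨a, b, c⟩) | ⟨a, c⟩))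
      ((⟨a', b', c'⟩ | ⟨a', b', c'⟩) | ((⟨a', b', c'⟩ | ⟨a', b', c'⟩) | ⟨a', c'⟩)) h <;>
    simp only [monoMap, Subtype.mk.injEq, Prod.mk.injEq] at h <;>
    first
    | (exfalso; omega)
    | (simp only [Sum.inl.injEq, Sum.inr.injEq, Prod.mk.injEq]; omega)
  · rintro ⟨⟨x, y, z⟩, h1, h2⟩
    simp only at h1 h2
    by_cases hz : 0 ≤ z
    · refine ⟨.inl (.inl ((x - y - 1).toNat, (y - z - 1).toNat, z.toNat)), ?_⟩
      simp only [monoMap, Subtype.mk.injEq, Prod.mk.injEq]; omega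
    by_cases hx : x ≤ 0
    · refine ⟨.inl (.inr ((y - z - 1).toNat, (x - y - 1).toNat, (-x).toNat)), ?_⟩
      simp only [monoMap, Subtype.mk.injEq, Prod.mk.injEq]; omega
    rcases lt_trichotomy y 0 with hy | hy | hy
    · refine ⟨.inr (.inl (.inr ((y - z - 1).toNat, (-y - 1).toNat, (x - 1).toNat))), ?_⟩
      simp only [monoMap, Subtype.mk.injEq, Prod.mk.injEq]; omega
    · refine ⟨.inr (.inr ((x - 1).toNat, (-z - 1).toNat)), ?_⟩
      simp only [monoMap, Subtype.mk.injEq, Prod.mk.injEq]; omega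
    · refine ⟨.inr (.inl (.inl ((x - y - 1).toNat, (y - 1).toNat, (-z - 1).toNat))), ?_⟩
      simp only [monoMap, Subtype.mk.injEq, Prod.mk.injEq]; omega

theorem mono_aux_pow (t : K) (z : ℤ) (n : ℕ) (h : z = n) : t ^ z = t ^ n := by
  rw [h, zpow_natCast]

theorem mono_aux_congr {ι : Type*} {f g : ι → K} {a : K} (h : ∀ x, f x = g x)
    (hg : HasSum g a) : HasSum f a := by
  have e : f = g := funext h
  rw [e]; exact hg

theorem mono_hasSum (s : ℕ) (t : K) (ht : ‖t‖ < 1) :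
    HasSum (fun p : MonoIdx =>
      t ^ ((4 * (s : ℤ)) * (p.1.1 - p.1.2.2) + |p.1.1| + |p.1.2.1| + |p.1.2.2|))
      (2 * t ^ (8 * s + 3) / ((1 - t ^ 3) * (1 - t ^ (4 * s + 1)) * (1 - t ^ (4 * s + 2)))
        + 2 * t ^ (12 * s + 4) / ((1 - t ^ (4 * s + 1)) ^ 2 * (1 - t ^ (4 * s + 2)))
        + t ^ (8 * s + 2) / (1 - t ^ (4 * s + 1)) ^ 2) := by
  have h1 := mono_aux_norm t ht (4 * s + 1) (by omega)
  have h2 := mono_aux_norm t ht (4 * s + 2) (by omega)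
  have h3 := mono_aux_norm t ht 3 (by omega)
  have A := (mono_aux_three _ _ _ h1 h2 h3).mul_left (t ^ (8 * s + 3))
  have B := (mono_aux_three _ _ _ h1 h2 h1).mul_left (t ^ (12 * s + 4))
  have C := (mono_aux_two _ _ h1 h1).1.mul_left (t ^ (8 * s + 2))
  rw [← (Equiv.ofBijective _ monoMap_bij).hasSum_iff]
  set F := (fun p : MonoIdx =>
      t ^ ((4 * (s : ℤ)) * (p.1.1 - p.1.2.2) + |p.1.1| + |p.1.2.1| + |p.1.2.2|)) ∘
        (Equiv.ofBijective _ monoMap_bij) with hF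
  have e1 : HasSum ((F ∘ Sum.inl) ∘ Sum.inl)
      (t ^ (8 * s + 3) * ((1 - t ^ (4 * s + 1))⁻¹ * ((1 - t ^ (4 * s + 2))⁻¹ * (1 - t ^ 3)⁻¹))) := by
    refine mono_aux_congr ?_ A
    rintro ⟨a, b, c⟩
    simp only [hF, Function.comp, Equiv.ofBijective_apply, monoMap, ← pow_mul, ← pow_add]
    apply mono_aux_pow
    rw [abs_of_nonneg (by omega), abs_of_nonneg (by omega), abs_of_nonneg (by omega)]
    push_cast; ring
  have e2 : HasSum ((F ∘ Sum.inl) ∘ Sum.inr)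
      (t ^ (8 * s + 3) * ((1 - t ^ (4 * s + 1))⁻¹ * ((1 - t ^ (4 * s + 2))⁻¹ * (1 - t ^ 3)⁻¹))) := by
    refine mono_aux_congr ?_ A
    rintro ⟨a, b, c⟩
    simp only [hF, Function.comp, Equiv.ofBijective_apply, monoMap, ← pow_mul, ← pow_add]
    apply mono_aux_pow
    rw [abs_of_nonpos (by omega), abs_of_nonpos (by omega), abs_of_nonpos (by omega)]
    push_cast; ring
  have e3 : HasSum (((F ∘ Sum.inr) ∘ Sum.inl) ∘ Sum.inl)
      (t ^ (12 * s + 4) * ((1 - t ^ (4 * s + 1))⁻¹ * ((1 - t ^ (4 * s + 2))⁻¹ * (1 - t ^ (4 * s + 1))⁻¹))) := by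
    refine mono_aux_congr ?_ B
    rintro ⟨a, b, c⟩
    simp only [hF, Function.comp, Equiv.ofBijective_apply, monoMap, ← pow_mul, ← pow_add]
    apply mono_aux_pow
    rw [abs_of_nonneg (by omega), abs_of_nonneg (by omega), abs_of_nonpos (by omega)]
    push_cast; ring
  have e4 : HasSum (((F ∘ Sum.inr) ∘ Sum.inl) ∘ Sum.inr)
      (t ^ (12 * s + 4) * ((1 - t ^ (4 * s + 1))⁻¹ * ((1 - t ^ (4 * s + 2))⁻¹ * (1 - t ^ (4 * s + 1))⁻¹))) := by
    refine mono_aux_congr ?_ B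
    rintro ⟨a, b, c⟩
    simp only [hF, Function.comp, Equiv.ofBijective_apply, monoMap, ← pow_mul, ← pow_add]
    apply mono_aux_pow
    rw [abs_of_nonneg (by omega), abs_of_nonpos (by omega), abs_of_nonpos (by omega)]
    push_cast; ring
  have e5 : HasSum ((F ∘ Sum.inr) ∘ Sum.inr)
      (t ^ (8 * s + 2) * ((1 - t ^ (4 * s + 1))⁻¹ * (1 - t ^ (4 * s + 1))⁻¹)) := by
    refine mono_aux_congr ?_ C
    rintro ⟨a, c⟩
    simp only [hF, Function.comp, Equiv.ofBijective_apply, monoMap, ← pow_mul, ← pow_add]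
    apply mono_aux_pow
    rw [abs_of_nonneg (by omega), abs_zero, abs_of_nonpos (by omega)]
    push_cast; ring
  have T := HasSum.sum (HasSum.sum e1 e2) (HasSum.sum (HasSum.sum e3 e4) e5)
  convert T using 1
  simp only [div_eq_mul_inv, mul_inv, ← inv_pow]
  ring
end helpers

/-- The regular part of the monopole formula sum for the Coulomb branch `M_C(r,3,1)`:
for `|t| < 1`, the family `t^{(4r−4)(n₁−n₃)+|n₁|+|n₂|+|n₃|}` over triples of integers
`n₁ > n₂ > n₃` is absolutely summable and its sum equals
`2t^{8r−5}/((1−t³)(1−t^{4r−3})(1−t^{4r−2})) + 2t^{12r−8}/((1−t^{4r−3})²(1−t^{4r−2}))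
+ t^{8r−6}/(1−t^{4r−3})²`. -/
theorem monopole_sum_regular_rank_three (r : ℕ) (hr : 1 ≤ r) (t : ℂ) (ht : ‖t‖ < 1) :
    Summable (fun p : {p : ℤ × ℤ × ℤ // p.2.1 < p.1 ∧ p.2.2 < p.2.1} =>
      ‖t ^ ((4 * (r : ℤ) - 4) * (p.1.1 - p.1.2.2) + |p.1.1| + |p.1.2.1| + |p.1.2.2|)‖) ∧
    ∑' p : {p : ℤ × ℤ × ℤ // p.2.1 < p.1 ∧ p.2.2 < p.2.1},
        t ^ ((4 * (r : ℤ) - 4) * (p.1.1 - p.1.2.2) + |p.1.1| + |p.1.2.1| + |p.1.2.2|) =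
      2 * t ^ (8 * r - 5) / ((1 - t ^ 3) * (1 - t ^ (4 * r - 3)) * (1 - t ^ (4 * r - 2)))
        + 2 * t ^ (12 * r - 8) / ((1 - t ^ (4 * r - 3)) ^ 2 * (1 - t ^ (4 * r - 2)))
        + t ^ (8 * r - 6) / (1 - t ^ (4 * r - 3)) ^ 2 := by
  obtain ⟨s, rfl⟩ : ∃ s, r = s + 1 := ⟨r - 1, by omega⟩
  have e0 : (4 * ((s + 1 : ℕ) : ℤ) - 4) = 4 * (s : ℤ) := by push_cast; ring
  have e1 : 8 * (s + 1) - 5 = 8 * s + 3 := by omega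
  have e2 : 4 * (s + 1) - 3 = 4 * s + 1 := by omega
  have e3 : 4 * (s + 1) - 2 = 4 * s + 2 := by omega
  have e4 : 12 * (s + 1) - 8 = 12 * s + 4 := by omega
  have e5 : 8 * (s + 1) - 6 = 8 * s + 2 := by omega
  rw [e0, e1, e2, e3, e4, e5]
  refine ⟨?_, (mono_hasSum s t ht).tsum_eq⟩
  have h := (mono_hasSum s ‖t‖ (by rwa [norm_norm])).summable
  simpa only [norm_zpow] using h
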